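/- arXiv:1506.01576 — 3 statements merged into one kernel-verified Lean document; each statement's English description precedes it below -/
import Mathlib

section
/- Let a21, a41, a50 be real numbers with a50 ≠ 0. If f2(a21,a41,a50) = 0 and f3(a21,a41,a50) = 0, then 37·a41⁶ + 36000·a41³·a50⁴ + 864000·a50⁸ = 0. -/
theorem resultant_f2_f3 (a21 a41 a50 : ℝ) (h50 : a50 ≠ 0)
    (hf2 : 28 * a21 * a41 ^ 4 + 252 * a21 ^ 2 * a41 ^ 2 * a50 ^ 2 + 800 * a41 ^ 3 * a50 ^ 2 + 567 * a21 ^ 3 * a50 ^ 4 + 3600 * a21 * a41 * a50 ^ 4 + 4500 * a50 ^ 6 = 0)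
    (hf3 : 4 * a21 ^ 2 * a41 ^ 4 + 36 * a21 ^ 3 * a41 ^ 2 * a50 ^ 2 + 100 * a21 * a41 ^ 3 * a50 ^ 2 + 81 * a21 ^ 4 * a50 ^ 4 + 450 * a21 ^ 2 * a41 * a50 ^ 4 - 125 * a41 ^ 2 * a50 ^ 4 = 0) :
    37 * a41 ^ 6 + 36000 * a41 ^ 3 * a50 ^ 4 + 864000 * a50 ^ 8 = 0 := by
  have h : a50 ^ 4 * (37 * a41 ^ 6 + 36000 * a41 ^ 3 * a50 ^ 4 + 864000 * a50 ^ 8) = 0 := by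
    linear_combination (192 * a50 ^ 6 + 1/15 * a41 ^ 3 * a50 ^ 2 - 768/5 * a21 * a41 * a50 ^ 4 - 7/375 * a21 * a41 ^ 4 + 2814/125 * a21 ^ 2 * a41 ^ 2 * a50 ^ 2 - 3024/125 * a21 ^ 3 * a50 ^ 4 + 666/625 * a21 ^ 3 * a41 ^ 3 + 2997/625 * a21 ^ 4 * a41 * a50 ^ 2) * hf2
      + (4716/5 * a41 * a50 ^ 4 + 49/375 * a41 ^ 4 - 23028/125 * a21 * a41 ^ 2 * a50 ^ 2 + 21168/125 * a21 ^ 2 * a50 ^ 4 - 4662/625 * a21 ^ 2 * a41 ^ 3 - 20979/625 * a21 ^ 3 * a41 * a50 ^ 2) * hf3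
  exact (mul_eq_zero.mp h).resolve_left (pow_ne_zero _ h50)
end

section
/- Let a41, a50 be real numbers with a50 ≠ 0. Then it is not the case that both 37·a41⁶ + 36000·a41³·a50⁴ + 864000·a50⁸ = 0 and 97384·a41⁹ − 98391600·a41⁶·a50⁴ + 24582976875·a41³·a50⁸ + 80858250000·a50¹² = 0. -/
theorem resultants_no_common_root (a41 a50 : ℝ) (h50 : a50 ≠ 0) :
    ¬((37 * a41 ^ 6 + 36000 * a41 ^ 3 * a50 ^ 4 + 864000 * a50 ^ 8 = 0) ∧
      (97384 * a41 ^ 9 - 98391600 * a41 ^ 6 * a50 ^ 4 + 24582976875 * a41 ^ 3 * a50 ^ 8 + 80858250000 * a50 ^ 12 = 0)) := by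
  rintro ⟨hp, hq⟩
  -- Euclidean division of the cubic by the quadratic, both homogeneous in `a41 ^ 3` and `a50 ^ 4`.
  have hrem : a50 ^ 8 * (7778599968375 * a41 ^ 3 + 169867825650000 * a50 ^ 4) = 0 := by
    linear_combination 37 * hq - (97384 * a41 ^ 3 - 193143600 * a50 ^ 4) * hp
  have hlin : a41 ^ 3 = -(16777069200 / 768256787) * a50 ^ 4 := by
    have := (mul_eq_zero.mp hrem).resolve_left (pow_ne_zero 8 h50)
    linear_combination this / 7778599968375
  have hzero : a50 ^ 8 = 0 := by
    have hsub : 37 * (a41 ^ 3) ^ 2 + 36000 * a41 ^ 3 * a50 ^ 4 + 864000 * a50 ^ 8 = 0 := by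
      linear_combination hp
    rw [hlin] at hsub
    linear_combination (590218490771563369 / 56355665872197756096000) * hsub
  exact pow_ne_zero 8 h50 hzero
end

section
/- Let a21, a41, a50 be real numbers with a50 ≠ 0. If f2(a21,a41,a50) = 0 and f3(a21,a41,a50) = 0, then J(a21,a41,a50) ≠ 0. -/
/-- The closed form of the Jacobian on the common zero locus, in the parameters `c = a50 ^ 2`,
`s = 2 * y ^ 2 + 9 * x * c` and `k = x * s / (y * c)`. -/
lemma jacobian_closed_form {x y c s k : ℝ}
    (hs : s = 2 * y ^ 2 + 9 * x * c) (hxs : x * s = k * (y * c))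
    (hk : k ^ 2 + 50 * k - 125 = 0) (hys : y * s * (7 * k + 400) = -4500 * c ^ 2) :
    (28 * x ^ 2 * y * s ^ 3 + 275 * x * s ^ 3 * c + 2200 * x * s ^ 2 * y ^ 2 * c
        + 12625 * y * s ^ 2 * c ^ 2 + 36500 * y ^ 3 * s * c ^ 2 + 450000 * y ^ 2 * c ^ 4)
        * (7 * k + 400) = 1265625 * (1 - k) * c ^ 4 * y ^ 2 := by
  have hys2 : y * s ^ 2 = 2 * y ^ 3 * s + 9 * k * y ^ 2 * c ^ 2 := by
    linear_combination y * s * hs + 9 * c * y * hxs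
  have hJ : 28 * x ^ 2 * y * s ^ 3 + 275 * x * s ^ 3 * c + 2200 * x * s ^ 2 * y ^ 2 * c
        + 12625 * y * s ^ 2 * c ^ 2 + 36500 * y ^ 3 * s * c ^ 2 + 450000 * y ^ 2 * c ^ 4
      = c ^ 2 * y ^ 2 * ((28 * k ^ 2 + 2200 * k + 36500) * (y * s) + 450000 * c ^ 2
        + (275 * k + 12625) * (2 * (y * s) + 9 * k * c ^ 2)) := by
    linear_combination (28 * y * s * (x * s + k * y * c) + 275 * s ^ 2 * c
      + 2200 * s * y ^ 2 * c) * hxs + c ^ 2 * (275 * k + 12625) * hys2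
  rw [hJ]
  linear_combination c ^ 2 * y ^ 2 * (28 * k ^ 2 + 2200 * k + 36500
    + 2 * (275 * k + 12625)) * hys
    + c ^ 4 * y ^ 2 * (-4500 * 28 + 63 * (275 * k + 12625) + 123750) * hk


theorem jacobian_nonzero (a21 a41 a50 : ℝ) (h50 : a50 ≠ 0)
    (hf2 : 28 * a21 * a41 ^ 4 + 252 * a21 ^ 2 * a41 ^ 2 * a50 ^ 2 + 800 * a41 ^ 3 * a50 ^ 2 + 567 * a21 ^ 3 * a50 ^ 4 + 3600 * a21 * a41 * a50 ^ 4 + 4500 * a50 ^ 6 = 0)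
    (hf3 : 4 * a21 ^ 2 * a41 ^ 4 + 36 * a21 ^ 3 * a41 ^ 2 * a50 ^ 2 + 100 * a21 * a41 ^ 3 * a50 ^ 2 + 81 * a21 ^ 4 * a50 ^ 4 + 450 * a21 ^ 2 * a41 * a50 ^ 4 - 125 * a41 ^ 2 * a50 ^ 4 = 0) :
    224 * a21 ^ 2 * a41 ^ 7 + 3024 * a21 ^ 3 * a41 ^ 5 * a50 ^ 2 + 11000 * a21 * a41 ^ 6 * a50 ^ 2 + 13608 * a21 ^ 4 * a41 ^ 3 * a50 ^ 4 + 108900 * a21 ^ 2 * a41 ^ 4 * a50 ^ 4 + 123500 * a41 ^ 5 * a50 ^ 4 + 20412 * a21 ^ 5 * a41 * a50 ^ 6 + 311850 * a21 ^ 3 * a41 ^ 2 * a50 ^ 6 + 783000 * a21 * a41 ^ 3 * a50 ^ 6 + 200475 * a21 ^ 4 * a50 ^ 8 + 1022625 * a21 ^ 2 * a41 * a50 ^ 8 + 450000 * a41 ^ 2 * a50 ^ 8 ≠ 0 := by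
  have hc : a50 ^ 2 ≠ 0 := pow_ne_zero 2 h50
  generalize hcdef : a50 ^ 2 = c at hc
  obtain ⟨s, hs⟩ : ∃ s, s = 2 * a41 ^ 2 + 9 * a21 * c := ⟨_, rfl⟩
  have h2 : 7 * a21 * s ^ 2 + 400 * a41 * s * c + 4500 * c ^ 3 = 0 := by
    subst hs hcdef
    linear_combination hf2
  have h3 : (a21 * s) ^ 2 + 50 * (a21 * s) * (a41 * c) - 125 * (a41 * c) ^ 2 = 0 := by
    subst hs hcdef
    linear_combination hf3
  have hy : a41 ≠ 0 := by
    rintro rfl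
    have hxs : a21 * s = 0 := by
      apply pow_eq_zero_iff two_ne_zero |>.mp
      linear_combination h3
    have : c ^ 3 = 0 := by
      linear_combination (1 / 4500) * h2 - (7 / 4500) * s * hxs
    exact hc (pow_eq_zero_iff three_ne_zero |>.mp this)
  have hyc : a41 * c ≠ 0 := mul_ne_zero hy hc
  obtain ⟨k, hxs⟩ : ∃ k, a21 * s = k * (a41 * c) := ⟨_, (div_mul_cancel₀ _ hyc).symm⟩
  have hk : k ^ 2 + 50 * k - 125 = 0 := by
    apply mul_left_cancel₀ (pow_ne_zero 2 hyc)
    rw [hxs] at h3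
    linear_combination h3
  have hys : a41 * s * (7 * k + 400) = -4500 * c ^ 2 := by
    apply mul_left_cancel₀ hc
    linear_combination h2 - 7 * s * hxs
  have hk1 : 1 - k ≠ 0 := by
    intro h
    obtain rfl : k = 1 := by linarith
    norm_num at hk
  intro hJ
  have hform := jacobian_closed_form hs hxs hk hys
  refine mul_ne_zero (mul_ne_zero (mul_ne_zero (by norm_num) hk1) (pow_ne_zero 4 hc))
    (pow_ne_zero 2 hy) (hform.symm.trans ?_)
  subst hs hcdef
  linear_combination (7 * k + 400) * hJ
end
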